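/- arXiv:math/0208127 — 4 statements merged into one kernel-verified Lean document; each statement's English description precedes it below -/
import Mathlib

section
/- For every integer K ≥ 1 one has ∫_{e^{−K}}^{1} −e^{(log r)² − π²} sin(2π log r) dr = (2π e^{π²})^{−1} ∫_{−2πK}^{0} −e^{t²/(4π²) + t/(2π)} sin t dt, and there exists K₀ such that for every integer K ≥ K₀ this quantity is strictly negative. -/
open Set intervalIntegral
open scoped Real

noncomputable section

/-- The substitution `r = exp s` in the integral along the segment. -/
theorem integral_segment_eq_exp_mul (K : ℝ) :
    (∫ r in Real.exp (-K)..1,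
        -(Real.exp ((Real.log r) ^ 2 - π ^ 2) * Real.sin (2 * π * Real.log r)))
      = Real.exp (-π ^ 2) *
        ∫ s in (-K)..0, -(Real.exp (s ^ 2 + s) * Real.sin (2 * π * s)) := by
  have h := intervalIntegral.integral_comp_mul_deriv' (a := -K) (b := 0) (f := Real.exp)
    (f' := Real.exp)
    (g := fun r => -(Real.exp ((Real.log r) ^ 2 - π ^ 2) * Real.sin (2 * π * Real.log r)))
    (fun x _ => Real.hasDerivAt_exp x) Real.continuous_exp.continuousOn (by
      have hlog : ContinuousOn Real.log (Real.exp '' uIcc (-K) 0) :=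
        Real.continuousOn_log.mono (by
          rintro _ ⟨x, -, rfl⟩
          exact (Real.exp_pos x).ne')
      fun_prop)
  rw [Real.exp_zero] at h
  rw [← h, ← intervalIntegral.integral_const_mul]
  congr 1
  ext s
  have e : Real.exp (s ^ 2 - π ^ 2) * Real.exp s = Real.exp (-π ^ 2) * Real.exp (s ^ 2 + s) := by
    rw [← Real.exp_add, ← Real.exp_add]
    ring_nf
  simp only [Function.comp_apply, Real.log_exp]
  linear_combination -Real.sin (2 * π * s) * e

/-- The substitution `t = 2 * π * s`. -/
theorem integral_exp_mul_sin_rescale (K : ℝ) :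
    (∫ t in (-(2 * π * K))..0,
        -(Real.exp (t ^ 2 / (4 * π ^ 2) + t / (2 * π)) * Real.sin t))
      = 2 * π * ∫ s in (-K)..0, -(Real.exp (s ^ 2 + s) * Real.sin (2 * π * s)) := by
  have h := intervalIntegral.mul_integral_comp_mul_left (a := -K) (b := 0)
    (f := fun t => -(Real.exp (t ^ 2 / (4 * π ^ 2) + t / (2 * π)) * Real.sin t)) (2 * π)
  rw [mul_zero, mul_neg] at h
  rw [← h]
  congr 2
  ext s
  have e : (2 * π * s) ^ 2 / (4 * π ^ 2) + 2 * π * s / (2 * π) = s ^ 2 + s := by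
    field_simp
    ring
  rw [e]

/-- On `[-1, 0]` the integrand is antisymmetric about `-1 / 2`. -/
theorem integral_exp_mul_sin_neg_one_zero :
    (∫ s in (-1 : ℝ)..0, -(Real.exp (s ^ 2 + s) * Real.sin (2 * π * s))) = 0 := by
  have h := intervalIntegral.integral_comp_sub_left (a := -1) (b := 0)
    (fun s : ℝ => -(Real.exp (s ^ 2 + s) * Real.sin (2 * π * s))) (-1)
  have e : ∀ s : ℝ, -(Real.exp ((-1 - s) ^ 2 + (-1 - s)) * Real.sin (2 * π * (-1 - s)))
      = - -(Real.exp (s ^ 2 + s) * Real.sin (2 * π * s)) := by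
    intro s
    have hs : Real.sin (2 * π * (-1 - s)) = -Real.sin (2 * π * s) := by
      rw [show 2 * π * (-1 - s) = -(2 * π * s) - 2 * π by ring, Real.sin_sub_two_pi, Real.sin_neg]
    rw [hs, show (-1 - s) ^ 2 + (-1 - s) = s ^ 2 + s by ring]
    ring
  simp only [e, intervalIntegral.integral_neg] at h
  norm_num at h ⊢
  linarith

/-- Integrating by parts against `(cos (2 * π * s) - 1) / (2 * π)`, which vanishes at integers. -/
theorem integral_exp_mul_sin_neg {K : ℕ} (hK : 2 ≤ K) :
    (∫ s in (-(K : ℝ))..(-1), -(Real.exp (s ^ 2 + s) * Real.sin (2 * π * s))) < 0 := by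
  have hK' : (2 : ℝ) ≤ K := by exact_mod_cast hK
  set p : ℝ → ℝ := fun s =>
    (2 * s + 1) * Real.exp (s ^ 2 + s) * ((Real.cos (2 * π * s) - 1) / (2 * π)) with hp
  have hpc : Continuous p := by fun_prop
  have hfc : Continuous fun s : ℝ => -(Real.exp (s ^ 2 + s) * Real.sin (2 * π * s)) := by
    fun_prop
  have hderiv : ∀ s : ℝ, HasDerivAt
      (fun s => Real.exp (s ^ 2 + s) * ((Real.cos (2 * π * s) - 1) / (2 * π)))
      (p s + -(Real.exp (s ^ 2 + s) * Real.sin (2 * π * s))) s := by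
    intro s
    have h1 : HasDerivAt (fun s : ℝ => s ^ 2 + s) (2 * s + 1) s := by
      simpa using (hasDerivAt_pow 2 s).fun_add (hasDerivAt_id' s)
    have h2 : HasDerivAt (fun s : ℝ => 2 * π * s) (2 * π) s := by
      simpa using (hasDerivAt_id s).const_mul (2 * π)
    refine (h1.exp.fun_mul ((h2.cos.sub_const 1).div_const (2 * π))).congr_deriv ?_
    simp only [hp]
    field_simp
  have hftc := intervalIntegral.integral_eq_sub_of_hasDerivAt (a := -(K : ℝ)) (b := -1)
    (fun s _ => hderiv s) ((hpc.add hfc).intervalIntegrable _ _)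
  have hcos : Real.cos (2 * π * -(K : ℝ)) = 1 := by
    rw [mul_neg, Real.cos_neg, mul_comm, Real.cos_nat_mul_two_pi]
  have hcos1 : Real.cos (2 * π * -1) = 1 := by
    rw [mul_neg, mul_one, Real.cos_neg, Real.cos_two_pi]
  rw [intervalIntegral.integral_add (hpc.intervalIntegrable _ _) (hfc.intervalIntegrable _ _),
    hcos, hcos1] at hftc
  have hpos : 0 < ∫ s in (-(K : ℝ))..(-1), p s := by
    refine intervalIntegral.integral_pos (by linarith) hpc.continuousOn (fun s hs => ?_)
      ⟨-(3 / 2), ⟨by linarith, by norm_num⟩, ?_⟩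
    · refine mul_nonneg_of_nonpos_of_nonpos
        (mul_nonpos_of_nonpos_of_nonneg (by linarith [hs.2]) (Real.exp_pos _).le) ?_
      exact div_nonpos_of_nonpos_of_nonneg (by linarith [Real.cos_le_one (2 * π * s)])
        Real.two_pi_pos.le
    · have hc : Real.cos (2 * π * -(3 / 2)) = -1 := by
        rw [show 2 * π * -(3 / 2) = -(π + 2 * π) by ring, Real.cos_neg, Real.cos_add_two_pi,
          Real.cos_pi]
      simp only [hp, hc]
      refine mul_pos_of_neg_of_neg (mul_neg_of_neg_of_pos (by norm_num) (Real.exp_pos _)) ?_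
      exact div_neg_of_neg_of_pos (by norm_num) Real.two_pi_pos
  norm_num at hftc ⊢
  linarith

/-- **The integral of `u` along the segment `AA₂` (Lemma 2.1, computation).**
For every integer `K ≥ 1`,
`∫_{e^{-K}}^{1} -e^{(log r)² - π²} sin(2π log r) dr
  = (2π e^{π²})⁻¹ ∫_{-2πK}^{0} -e^{t²/(4π²) + t/(2π)} sin t dt`,
and this quantity is strictly negative for all sufficiently large integers `K`. -/
theorem segment_integral_formula_and_negativity :
    (∀ K : ℕ, 1 ≤ K →
      (∫ r in Real.exp (-(K : ℝ))..1,
          -(Real.exp ((Real.log r) ^ 2 - π ^ 2) * Real.sin (2 * π * Real.log r)))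
        = (2 * π * Real.exp (π ^ 2))⁻¹ *
          ∫ t in (-(2 * π * (K : ℝ)))..0,
            -(Real.exp (t ^ 2 / (4 * π ^ 2) + t / (2 * π)) * Real.sin t)) ∧
    ∃ K₀ : ℕ, ∀ K : ℕ, K₀ ≤ K →
      (∫ r in Real.exp (-(K : ℝ))..1,
          -(Real.exp ((Real.log r) ^ 2 - π ^ 2) * Real.sin (2 * π * Real.log r))) < 0 := by
  refine ⟨fun K _ => ?_, 2, fun K hK => ?_⟩
  · rw [integral_segment_eq_exp_mul, integral_exp_mul_sin_rescale, Real.exp_neg, ← mul_assoc]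
    congr 1
    field_simp
  · have hfc : Continuous fun s : ℝ => -(Real.exp (s ^ 2 + s) * Real.sin (2 * π * s)) := by
      fun_prop
    rw [integral_segment_eq_exp_mul, ← intervalIntegral.integral_add_adjacent_intervals
      (hfc.intervalIntegrable _ (-1)) (hfc.intervalIntegrable _ _),
      integral_exp_mul_sin_neg_one_zero, add_zero]
    exact mul_neg_of_pos_of_neg (Real.exp_pos _) (integral_exp_mul_sin_neg hK)

end
end

section
/- Let ψ ∈ C¹([−1, 1]) satisfy 0 ≤ ψ ≤ 1 and ψ(±1) = 0, and set γ = {(ψ(x₂), x₂) : |x₂| ≤ 1}, Q = {(x₁, x₂) : 0 < x₁ < ψ(x₂), |x₂| ≤ 1}, Π = [0, 2] × [−2, 2], and F = Π ∖ Q. Let τ ∈ (0, 1). Then there exists ε > 0 with the following property. Suppose f is of class C² on an open neighborhood of Π, f is concave on Π, det D²f = 0 on Π, and ‖D²f(x) − M_τ‖ ≤ ετ for all x ∈ Π, where M_τ is the 2×2 matrix with M₁₁ = M₁₂ = M₂₁ = 0 and M₂₂ = −τ. Suppose w is of class C³ on an open neighborhood of Π with w = f on F, det D²w(x) ≤ 0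 for all x ∈ Π, and ‖D²w − M_τ‖_{C¹(Π)} ≤ ετ (i.e., both D²w(x) − M_τ and the first derivatives of the entries of D²w are bounded in norm by ετ on Π). Then f(x) ≤ w(x) for all x ∈ Π. -/
open Set Metric

noncomputable section

/-- The Euclidean plane. -/
abbrev E2 := EuclideanSpace ℝ (Fin 2)

/-- The second partial derivative `∂²f/∂xᵢ∂xⱼ`. -/
def pderiv2 (i j : Fin 2) (f : E2 → ℝ) (x : E2) : ℝ :=
  fderiv ℝ (fun y => fderiv ℝ f y (EuclideanSpace.single j 1)) x (EuclideanSpace.single i 1)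

/-- The Hessian matrix `D²f` of a function on the plane. -/
def hess (f : E2 → ℝ) (x : E2) : Matrix (Fin 2) (Fin 2) ℝ :=
  Matrix.of fun i j => pderiv2 i j f x

/-- The third partial derivative `∂³f/∂x_k∂xᵢ∂xⱼ` (a first derivative of an entry of the
Hessian). -/
def pderiv3 (k i j : Fin 2) (f : E2 → ℝ) (x : E2) : ℝ :=
  fderiv ℝ (fun y => pderiv2 i j f y) x (EuclideanSpace.single k 1)

/-- The rectangle `Π = [0,2] × [-2,2]`. -/
def Piset : Set E2 := {x : E2 | x 0 ∈ Icc (0:ℝ) 2 ∧ x 1 ∈ Icc (-2:ℝ) 2}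

/-- The region `Q = {0 < x₁ < ψ(x₂), |x₂| ≤ 1}` below the curve `γ`. -/
def Qset (ψ : ℝ → ℝ) : Set E2 := {x : E2 | |x 1| ≤ 1 ∧ 0 < x 0 ∧ x 0 < ψ (x 1)}

/-- `F = Π \ Q`. -/
def Fset (ψ : ℝ → ℝ) : Set E2 := Piset \ Qset ψ

/-- The model Hessian `M_τ` with entries `M₁₁ = M₁₂ = M₂₁ = 0`, `M₂₂ = -τ`. -/
def Mmat (τ : ℝ) : Matrix (Fin 2) (Fin 2) ℝ := !![0, 0; 0, -τ]

open Filter Topology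

theorem hess_apply_eq_fderiv_fderiv {w : E2 → ℝ} {x : E2}
    (hw : DifferentiableAt ℝ (fderiv ℝ w) x) (i j : Fin 2) :
    hess w x i j = fderiv ℝ (fderiv ℝ w) x (EuclideanSpace.single i 1)
      (EuclideanSpace.single j 1) := by
  simp only [hess, Matrix.of_apply, pderiv2]
  rw [fderiv_clm_apply hw (differentiableAt_const _)]
  simp

theorem eq_add_smul_single (v : E2) :
    v = v 0 • EuclideanSpace.single 0 (1 : ℝ) + v 1 • EuclideanSpace.single 1 (1 : ℝ) := by
  ext i
  fin_cases i <;> simp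

theorem fderiv_fderiv_apply_eq_hess {w : E2 → ℝ} {x : E2}
    (hw : DifferentiableAt ℝ (fderiv ℝ w) x) (u v : E2) :
    fderiv ℝ (fderiv ℝ w) x u v =
      u 0 * v 0 * hess w x 0 0 + u 0 * v 1 * hess w x 0 1
        + u 1 * v 0 * hess w x 1 0 + u 1 * v 1 * hess w x 1 1 := by
  simp only [hess_apply_eq_fderiv_fderiv hw]
  conv_lhs => rw [eq_add_smul_single u, eq_add_smul_single v]
  simp only [map_add, map_smul, add_apply, smul_apply, smul_eq_mul]
  ring

theorem hess_symm {w : E2 → ℝ} {x : E2} (hw : ContDiffAt ℝ 2 w x) :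
    hess w x 0 1 = hess w x 1 0 := by
  have hd : DifferentiableAt ℝ (fderiv ℝ w) x :=
    (hw.fderiv_right (m := 1) (by norm_num)).differentiableAt (by norm_num)
  rw [hess_apply_eq_fderiv_fderiv hd, hess_apply_eq_fderiv_fderiv hd]
  exact (hw.isSymmSndFDerivAt (by simp)).eq _ _

theorem hasDerivAt_add_smul (x v : E2) (r : ℝ) :
    HasDerivAt (fun r : ℝ => x + r • v) v r := by
  simpa using ((hasDerivAt_id r).smul_const v).const_add x

theorem ContDiffAt.hasDerivAt_comp_line {w : E2 → ℝ} {x v : E2} {r : ℝ}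
    (hw : ContDiffAt ℝ 2 w (x + r • v)) :
    HasDerivAt (fun r : ℝ => w (x + r • v)) (fderiv ℝ w (x + r • v) v) r :=
  (hw.differentiableAt (by norm_num)).hasFDerivAt.comp_hasDerivAt r (hasDerivAt_add_smul x v r)

theorem ContDiffAt.hasDerivAt_fderiv_comp_line {w : E2 → ℝ} {x v : E2} {r : ℝ}
    (hw : ContDiffAt ℝ 2 w (x + r • v)) (u : E2) :
    HasDerivAt (fun r : ℝ => fderiv ℝ w (x + r • v) u)
      (v 0 * u 0 * hess w (x + r • v) 0 0 + v 0 * u 1 * hess w (x + r • v) 0 1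
        + v 1 * u 0 * hess w (x + r • v) 1 0 + v 1 * u 1 * hess w (x + r • v) 1 1) r := by
  have hd : DifferentiableAt ℝ (fderiv ℝ w) (x + r • v) :=
    (hw.fderiv_right (m := 1) (by norm_num)).differentiableAt (by norm_num)
  rw [← fderiv_fderiv_apply_eq_hess hd]
  have h := hd.hasFDerivAt.comp_hasDerivAt r (hasDerivAt_add_smul x v r)
  simpa using h.clm_apply (hasDerivAt_const r u)

theorem HasDerivAt.nonpos_of_eventually_le {h : ℝ → ℝ} {c a : ℝ} (hc : HasDerivAt h c a)
    (hle : ∀ᶠ r in 𝓝[>] a, h r ≤ h a) : c ≤ 0 := by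
  have ht := (hasDerivWithinAt_iff_tendsto_slope' (by simp)).1 (hc.hasDerivWithinAt (s := Ioi a))
  refine le_of_tendsto ht ?_
  filter_upwards [hle, self_mem_nhdsWithin] with r hr hra
  rw [slope_def_field]
  exact div_nonpos_of_nonpos_of_nonneg (by linarith) (by linarith [mem_Ioi.1 hra])

theorem IsLocalMax.second_deriv_nonpos {g g' : ℝ → ℝ} {c a : ℝ} (hmax : IsLocalMax g a)
    (hg : ∀ᶠ r in 𝓝 a, HasDerivAt g (g' r) r) (hg' : HasDerivAt g' c a) : c ≤ 0 := by
  by_contra! hc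
  have hder : deriv g =ᶠ[𝓝 a] g' := hg.mono fun r hr => hr.deriv
  have hmin : IsLocalMin g a := by
    refine isLocalMin_of_deriv_deriv_pos ?_ hmax.deriv_eq_zero hg.self_of_nhds.continuousAt
    rwa [hder.deriv_eq, hg'.deriv]
  have hconst : g =ᶠ[𝓝 a] fun _ => g a := by
    filter_upwards [hmax, hmin] with r h₁ h₂ using le_antisymm h₁ h₂
  have h0 : g' =ᶠ[𝓝 a] fun _ => 0 := by
    filter_upwards [hder, hconst.eventuallyEq_nhds] with r h₁ h₂
    rw [← h₁, h₂.deriv_eq, deriv_const]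
  have := hg'.unique ((hasDerivAt_const a (0 : ℝ)).congr_of_eventuallyEq h0)
  linarith

/-- The closed rectangle `[s, t] × [c, d]`. -/
def rectangle (s t c d : ℝ) : Set E2 := {z | z 0 ∈ Icc s t ∧ z 1 ∈ Icc c d}

theorem isCompact_rectangle (s t c d : ℝ) : IsCompact (rectangle s t c d) := by
  have h := (isCompact_univ_pi (s := ![Icc s t, Icc c d]) (by
    intro i; fin_cases i <;> exact isCompact_Icc))
  convert (EuclideanSpace.equiv (Fin 2) ℝ).toHomeomorph.isCompact_preimage.2 h using 1
  ext z
  simp [rectangle, Set.mem_pi, Fin.forall_fin_two]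

/-- Comparison with affine functions: a function with nonpositive Hessian determinant, strictly
concave in the second variable, lies below an affine function as soon as it does so on the vertical
sides and the difference points inwards on the horizontal sides. -/
theorem le_affine_of_hess_det_nonpos {w : E2 → ℝ} {s t c d α β p : ℝ} (hcd : c < d)
    (hw : ∀ z ∈ rectangle s t c d, ContDiffAt ℝ 2 w z)
    (hdet : ∀ z ∈ rectangle s t c d, (hess w z).det ≤ 0)
    (hneg : ∀ z ∈ rectangle s t c d, hess w z 1 1 < 0)
    (hs : ∀ z ∈ rectangle s t c d, z 0 = s → w z ≤ α + β * z 0 + p * z 1)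
    (ht : ∀ z ∈ rectangle s t c d, z 0 = t → w z ≤ α + β * z 0 + p * z 1)
    (hd : ∀ z ∈ rectangle s t c d, z 1 = d → fderiv ℝ w z (EuclideanSpace.single 1 1) < p)
    (hc : ∀ z ∈ rectangle s t c d, z 1 = c → p < fderiv ℝ w z (EuclideanSpace.single 1 1)) :
    ∀ z ∈ rectangle s t c d, w z ≤ α + β * z 0 + p * z 1 := by
  intro x hx
  suffices H : ∀ δ > 0, w x - (α + β * x 0 + p * x 1) + δ * ((x 0 - s) * (x 0 - t)) ≤ 0 by
    have hlim : Tendsto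
        (fun δ : ℝ => w x - (α + β * x 0 + p * x 1) + δ * ((x 0 - s) * (x 0 - t))) (𝓝[>] 0)
        (𝓝 (w x - (α + β * x 0 + p * x 1) + 0 * ((x 0 - s) * (x 0 - t)))) :=
      (Continuous.tendsto (by fun_prop) 0).mono_left nhdsWithin_le_nhds
    have := le_of_tendsto hlim (by filter_upwards [self_mem_nhdsWithin] with δ hδ using H δ hδ)
    linarith
  intro δ hδ
  set φ : E2 → ℝ :=
    fun z => w z - (α + β * z 0 + p * z 1) + δ * ((z 0 - s) * (z 0 - t)) with hφ
  have hcont : ContinuousOn φ (rectangle s t c d) := by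
    have : ContinuousOn w (rectangle s t c d) :=
      fun z hz => (hw z hz).continuousAt.continuousWithinAt
    fun_prop
  obtain ⟨z, hz, hmax⟩ := (isCompact_rectangle s t c d).exists_isMaxOn ⟨x, hx⟩ hcont
  refine (hmax hx).trans ?_
  have hline : ∀ v : E2, ∀ r : ℝ, ContDiffAt ℝ 2 w (z + r • v) →
      HasDerivAt (fun r : ℝ => φ (z + r • v))
        (fderiv ℝ w (z + r • v) v - (β * v 0 + p * v 1)
          + δ * (v 0 * (2 * (z 0 + r * v 0) - s - t))) r := by
    intro v r hr
    have h0 : HasDerivAt (fun r : ℝ => z 0 + r * v 0) (v 0) r := by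
      simpa using ((hasDerivAt_id r).mul_const (v 0)).const_add (z 0)
    have h1 : HasDerivAt (fun r : ℝ => z 1 + r * v 1) (v 1) r := by
      simpa using ((hasDerivAt_id r).mul_const (v 1)).const_add (z 1)
    exact ((hr.hasDerivAt_comp_line.sub
      (((h0.const_mul β).const_add α).add (h1.const_mul p))).add
      (((h0.sub_const s).mul (h0.sub_const t)).const_mul δ)).congr_deriv (by ring)
  have hz0 := hz.1
  have hz1 := hz.2
  rcases hz0.1.eq_or_lt with h | hsz
  · have := hs z hz h.symm
    simp only [hφ, ← h, sub_self, zero_mul, mul_zero] at this ⊢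
    linarith
  rcases hz0.2.eq_or_lt with h | htz
  · have := ht z hz h
    simp only [hφ, h, sub_self, mul_zero] at this ⊢
    linarith
  exfalso
  have hinward : ∀ σ : ℝ, (∀ᶠ r in 𝓝[>] (0 : ℝ), z 1 + r * σ ∈ Icc c d) →
      σ * (fderiv ℝ w z (EuclideanSpace.single 1 1) - p) ≤ 0 := by
    intro σ hσ
    have h := hline (σ • EuclideanSpace.single 1 1) 0 (by simpa using hw z hz)
    have := h.nonpos_of_eventually_le (by
      filter_upwards [hσ] with r hr
      simp only [zero_smul, add_zero]
      refine hmax ⟨by simpa using hz.1, by simpa using hr⟩)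
    simp only [zero_smul, add_zero, map_smul, smul_eq_mul, PiLp.smul_apply,
      PiLp.single_apply] at this
    norm_num at this
    linarith
  rcases hz1.2.eq_or_lt with h | hdz
  · have := hinward (-1) (by
      filter_upwards [Ioo_mem_nhdsGT (sub_pos.2 hcd)] with r hr
      constructor <;> linarith [hr.1, hr.2])
    linarith [hd z hz h]
  rcases hz1.1.eq_or_lt with h | hcz
  · have := hinward 1 (by
      filter_upwards [Ioo_mem_nhdsGT (sub_pos.2 hcd)] with r hr
      constructor <;> linarith [hr.1, hr.2])
    linarith [hc z hz h.symm]
  have hnhds : rectangle s t c d ∈ 𝓝 z := by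
    have e0 : ∀ᶠ y : E2 in 𝓝 z, y 0 ∈ Icc s t :=
      (by fun_prop : ContinuousAt (fun y : E2 => y 0) z).eventually (Icc_mem_nhds hsz htz)
    have e1 : ∀ᶠ y : E2 in 𝓝 z, y 1 ∈ Icc c d :=
      (by fun_prop : ContinuousAt (fun y : E2 => y 1) z).eventually (Icc_mem_nhds hcz hdz)
    exact e0.and e1
  set v : E2 := !₂[hess w z 1 1, -hess w z 0 1] with hv
  have hv0 : v 0 = hess w z 1 1 := by simp [hv]
  have hv1 : v 1 = -hess w z 0 1 := by simp [hv]
  have hlinecont : Tendsto (fun r : ℝ => z + r • v) (𝓝 0) (𝓝 z) := by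
    simpa using (hasDerivAt_add_smul z v 0).continuousAt.tendsto
  have hev := hlinecont.eventually hnhds
  have hlocal : IsLocalMax (fun r : ℝ => φ (z + r • v)) 0 := by
    filter_upwards [hev] with r hr
    simpa using hmax hr
  have hsecond : HasDerivAt (fun r : ℝ => fderiv ℝ w (z + r • v) v - (β * v 0 + p * v 1)
      + δ * (v 0 * (2 * (z 0 + r * v 0) - s - t)))
      (v 0 * v 0 * hess w z 0 0 + v 0 * v 1 * hess w z 0 1
        + v 1 * v 0 * hess w z 1 0 + v 1 * v 1 * hess w z 1 1 + δ * (v 0 * (2 * v 0))) 0 := by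
    have h2 := (show ContDiffAt ℝ 2 w (z + (0 : ℝ) • v) by
      simpa using hw z hz).hasDerivAt_fderiv_comp_line v
    have h0 : HasDerivAt (fun r : ℝ => z 0 + r * v 0) (v 0) 0 := by
      simpa using ((hasDerivAt_id (0 : ℝ)).mul_const (v 0)).const_add (z 0)
    have := (h2.sub_const (β * v 0 + p * v 1)).add
      (((((h0.const_mul 2).sub_const s).sub_const t).const_mul (v 0)).const_mul δ)
    simp only [zero_smul, add_zero] at this
    exact this
  have hle := hlocal.second_deriv_nonpos
    (hev.mono fun r hr => hline v r (hw _ hr)) hsecond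
  have hdz := hdet z hz
  have hnz := hneg z hz
  rw [Matrix.det_fin_two] at hdz
  rw [hv0, hv1, ← hess_symm (hw z hz)] at hle
  rw [← hess_symm (hw z hz)] at hdz
  nlinarith [mul_nonneg_of_nonpos_of_nonpos hdz hnz.le, mul_pos hδ (mul_pos_of_neg_of_neg hnz hnz)]

theorem convex_rectangle (s t c d : ℝ) : Convex ℝ (rectangle s t c d) := by
  intro x hx y hy a b ha hb hab
  exact ⟨convex_Icc s t hx.1 hy.1 ha hb hab, convex_Icc c d hx.2 hy.2 ha hb hab⟩

/-- If the second variable dominates the Hessian of `w` and `det D²w ≤ 0`, then on a rectangle whose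
left side has midpoint `x` there is an affine function above `w` which agrees with `w` at `x` and at
some point of the right side. -/
theorem exists_affine_majorant {w : E2 → ℝ} {τ t : ℝ} (hτ : 0 < τ) {x : E2}
    (hxt : x 0 < t) (htx : t ≤ x 0 + 2)
    (hw : ∀ z ∈ rectangle (x 0) t (x 1 - 1 / 2) (x 1 + 1 / 2), ContDiffAt ℝ 2 w z)
    (hdet : ∀ z ∈ rectangle (x 0) t (x 1 - 1 / 2) (x 1 + 1 / 2), (hess w z).det ≤ 0)
    (h01 : ∀ z ∈ rectangle (x 0) t (x 1 - 1 / 2) (x 1 + 1 / 2), |hess w z 0 1| ≤ τ / 10)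
    (h11 : ∀ z ∈ rectangle (x 0) t (x 1 - 1 / 2) (x 1 + 1 / 2), |hess w z 1 1 + τ| ≤ τ / 10) :
    ∃ P ∈ rectangle (x 0) t (x 1 - 1 / 2) (x 1 + 1 / 2), P 0 = t ∧ ∃ α β p : ℝ,
      w x = α + β * x 0 + p * x 1 ∧ w P = α + β * P 0 + p * P 1 ∧
      ∀ z ∈ rectangle (x 0) t (x 1 - 1 / 2) (x 1 + 1 / 2), w z ≤ α + β * z 0 + p * z 1 := by
  set R := rectangle (x 0) t (x 1 - 1 / 2) (x 1 + 1 / 2) with hR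
  have hxR : x ∈ R := ⟨⟨le_rfl, hxt.le⟩, by constructor <;> linarith⟩
  have hneg : ∀ z ∈ R, hess w z 1 1 < 0 := fun z hz => by
    linarith [(abs_le.1 (h11 z hz)).2]
  have hseg : ∀ z ∈ R, ∀ r ∈ Icc (0 : ℝ) 1, x + r • (z - x) ∈ R := fun z hz r hr =>
    (convex_rectangle _ _ _ _).add_smul_sub_mem hxR hz hr
  set p := fderiv ℝ w x (EuclideanSpace.single 1 1) with hp
  have hgrad : ∀ z ∈ R, ∃ ζ ∈ R, fderiv ℝ w z (EuclideanSpace.single 1 1) - p =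
      (z 0 - x 0) * hess w ζ 0 1 + (z 1 - x 1) * hess w ζ 1 1 := by
    intro z hz
    have hder : ∀ r ∈ Icc (0 : ℝ) 1, _ := fun r hr =>
      (hw _ (hseg z hz r hr)).hasDerivAt_fderiv_comp_line (EuclideanSpace.single 1 1)
    obtain ⟨r, hr, h⟩ := exists_hasDerivAt_eq_slope _ _ zero_lt_one
      (fun r hr => (hder r hr).continuousAt.continuousWithinAt)
      (fun r hr => hder r (Ioo_subset_Icc_self hr))
    refine ⟨_, hseg z hz r (Ioo_subset_Icc_self hr), ?_⟩
    simp only [one_smul, zero_smul, add_zero, add_sub_cancel, sub_zero, div_one] at h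
    rw [hp, ← h]
    simp
  obtain ⟨P, hP, hPmax⟩ := (isCompact_rectangle t t (x 1 - 1 / 2) (x 1 + 1 / 2)).exists_isMaxOn
    (f := fun z => w z - p * z 1)
    ⟨!₂[t, x 1], by simp [rectangle]⟩ (by
      have : ContinuousOn w (rectangle t t (x 1 - 1 / 2) (x 1 + 1 / 2)) := fun z hz =>
        (hw z ⟨⟨hxt.le.trans hz.1.1, hz.1.2⟩, hz.2⟩).continuousAt.continuousWithinAt
      fun_prop)
  have hP0 : P 0 = t := le_antisymm hP.1.2 hP.1.1
  have hsub : t - x 0 ≠ 0 := (sub_pos.2 hxt).ne'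
  set β := (w P - w x - p * (P 1 - x 1)) / (t - x 0) with hβ
  have hβ' : β * (t - x 0) = w P - w x - p * (P 1 - x 1) := div_mul_cancel₀ _ hsub
  refine ⟨P, ⟨⟨hP0 ▸ hxt.le, hP0.le⟩, hP.2⟩, hP0, w x - β * x 0 - p * x 1, β, p,
    by ring, by rw [hP0]; linarith, ?_⟩
  refine le_affine_of_hess_det_nonpos (by linarith) hw hdet hneg ?_ ?_ ?_ ?_
  · intro z hz hz0
    have hder : ∀ r ∈ Icc (0 : ℝ) 1, _ := fun r hr =>
      (hw _ (hseg z hz r hr)).hasDerivAt_comp_line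
    obtain ⟨r, hr, h⟩ := exists_hasDerivAt_eq_slope _ _ zero_lt_one
      (fun r hr => (hder r hr).continuousAt.continuousWithinAt)
      (fun r hr => hder r (Ioo_subset_Icc_self hr))
    have hy := hseg z hz r (Ioo_subset_Icc_self hr)
    simp only [one_smul, zero_smul, add_zero, add_sub_cancel, sub_zero, div_one] at h
    have hzx : z - x = (z 1 - x 1) • EuclideanSpace.single 1 (1 : ℝ) := by
      conv_lhs => rw [eq_add_smul_single (z - x)]
      simp [hz0]
    obtain ⟨ζ, hζ, hg⟩ := hgrad _ hy
    have e0 : (x + r • (z - x)) 0 - x 0 = 0 := by simp [hz0]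
    have e1 : (x + r • (z - x)) 1 - x 1 = r * (z 1 - x 1) := by simp
    rw [e0, e1] at hg
    have happ : fderiv ℝ w (x + r • (z - x)) (z - x) =
        (z 1 - x 1) * fderiv ℝ w (x + r • (z - x)) (EuclideanSpace.single 1 1) := by
      conv_lhs => rw [show ∀ L : E2 →L[ℝ] ℝ, L (z - x) =
        L ((z 1 - x 1) • EuclideanSpace.single 1 (1 : ℝ)) from fun L => by rw [hzx]]
      simp
    rw [happ, eq_add_of_sub_eq hg] at h
    have hsq : r * (z 1 - x 1) ^ 2 * hess w ζ 1 1 ≤ 0 :=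
      mul_nonpos_of_nonneg_of_nonpos (mul_nonneg hr.1.le (sq_nonneg _)) (hneg ζ hζ).le
    rw [hz0]
    linarith
  · intro z hz hzt
    have := hPmax (show z ∈ rectangle t t _ _ from ⟨by simp [hzt], hz.2⟩)
    simp only [mem_ofPred_eq] at this
    rw [hzt]
    linarith
  · intro z hz hz1
    obtain ⟨ζ, hζ, hg⟩ := hgrad z hz
    have a := abs_le.1 (h01 ζ hζ)
    have b := abs_le.1 (h11 ζ hζ)
    have hz0 := hz.1
    rw [hz1] at hg
    nlinarith [mul_le_mul_of_nonneg_left a.2 (sub_nonneg.2 hz0.1), hz0.2]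
  · intro z hz hz1
    obtain ⟨ζ, hζ, hg⟩ := hgrad z hz
    have a := abs_le.1 (h01 ζ hζ)
    have b := abs_le.1 (h11 ζ hζ)
    have hz0 := hz.1
    rw [hz1] at hg
    nlinarith [mul_le_mul_of_nonneg_left a.1 (sub_nonneg.2 hz0.1), hz0.2]

/-- **Lemma 2.5 (comparison with the flat concave extension).**
Let `ψ ∈ C¹([-1,1])` with `0 ≤ ψ ≤ 1`, `ψ(±1) = 0`, and let `τ ∈ (0,1)`.  There is
`ε > 0` with the following property.  If `f` is `C²` near `Π = [0,2] × [-2,2]`, concave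
on `Π`, with `det D²f = 0` and `‖D²f - M_τ‖ ≤ ετ` on `Π`, and if `w` is `C³` near `Π`
with `w = f` on `F = Π \ Q`, `det D²w ≤ 0` on `Π` and `‖D²w - M_τ‖_{C¹(Π)} ≤ ετ`,
then `f ≤ w` on `Π`. -/
theorem comparison_with_flat_extension
    (ψ : ℝ → ℝ) (hψC1 : ContDiffOn ℝ 1 ψ (Icc (-1) 1))
    (hψ01 : ∀ s ∈ Icc (-1:ℝ) 1, 0 ≤ ψ s ∧ ψ s ≤ 1)
    (hψm1 : ψ (-1) = 0) (hψp1 : ψ 1 = 0)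
    (τ : ℝ) (hτ : τ ∈ Ioo (0:ℝ) 1) :
    ∃ ε : ℝ, 0 < ε ∧
      ∀ f w : E2 → ℝ,
        (∃ U : Set E2, IsOpen U ∧ Piset ⊆ U ∧ ContDiffOn ℝ 2 f U) →
        ConcaveOn ℝ Piset f →
        (∀ x ∈ Piset, (hess f x).det = 0) →
        (∀ x ∈ Piset, ∀ i j : Fin 2, |hess f x i j - Mmat τ i j| ≤ ε * τ) →
        (∃ V : Set E2, IsOpen V ∧ Piset ⊆ V ∧ ContDiffOn ℝ 3 w V) →
        (∀ x ∈ Fset ψ, w x = f x) →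
        (∀ x ∈ Piset, (hess w x).det ≤ 0) →
        (∀ x ∈ Piset, ∀ i j : Fin 2, |hess w x i j - Mmat τ i j| ≤ ε * τ ∧
          ∀ k : Fin 2, |pderiv3 k i j w x| ≤ ε * τ) →
        ∀ x ∈ Piset, f x ≤ w x := by
  obtain ⟨hτ, -⟩ := hτ
  refine ⟨1 / 10, by norm_num, ?_⟩
  rintro f w - hf - - ⟨V, hVo, hV, hw⟩ hwf hdet hhess x hx
  by_cases hxF : x ∈ Fset ψ
  · exact (hwf x hxF).ge
  obtain ⟨hx1, hx0, hxψ⟩ : x ∈ Qset ψ := by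
    by_contra h
    exact hxF ⟨hx, h⟩
  have hψ := fun z : E2 => fun h : |z 1| ≤ 1 => (hψ01 (z 1) (abs_le.1 h)).2
  have hx0' : x 0 < 1 := hxψ.trans_le (hψ x hx1)
  have hx1' := abs_le.1 hx1
  have hsub : rectangle (x 0) (3 / 2) (x 1 - 1 / 2) (x 1 + 1 / 2) ⊆ Piset := fun z hz =>
    ⟨⟨hx0.le.trans hz.1.1, hz.1.2.trans (by norm_num)⟩,
      by linarith [hz.2.1], by linarith [hz.2.2]⟩
  have hagree : ∀ z ∈ rectangle (x 0) (3 / 2) (x 1 - 1 / 2) (x 1 + 1 / 2), 1 ≤ z 0 →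
      w z = f z := fun z hz hz0 =>
    hwf z ⟨hsub hz, fun hQ => by linarith [hψ z hQ.1, hQ.2.2]⟩
  obtain ⟨P, hP, hP0, α, β, p, hwx, hwP, hle⟩ := exists_affine_majorant hτ (by linarith)
    (by linarith)
    (fun z hz => (hw.contDiffAt (hVo.mem_nhds (hV (hsub hz)))).of_le (by norm_num))
    (fun z hz => hdet z (hsub hz))
    (fun z hz => by
      have h := (hhess z (hsub hz) 0 1).1
      norm_num [Mmat] at h
      linarith)
    (fun z hz => by
      have h := (hhess z (hsub hz) 1 1).1
      norm_num [Mmat] at h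
      linarith)
  have hxR : x ∈ rectangle (x 0) (3 / 2) (x 1 - 1 / 2) (x 1 + 1 / 2) :=
    ⟨⟨le_rfl, by linarith⟩, by constructor <;> linarith⟩
  have hconc := hf.2 (hsub hP) hx (show (0 : ℝ) ≤ 2 / 3 by norm_num)
    (show (0 : ℝ) ≤ 1 / 3 by norm_num) (by norm_num)
  have hyR := convex_rectangle _ _ _ _ hP hxR (a := 2 / 3) (b := 1 / 3) (by norm_num)
    (by norm_num) (by norm_num)
  have hley := hle _ hyR
  rw [hagree _ hyR (by simp [hP0]; linarith)] at hley
  rw [← hagree P hP (by rw [hP0]; norm_num)] at hconc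
  simp only [PiLp.add_apply, PiLp.smul_apply, smul_eq_mul] at hley hconc
  linarith

end
end

section
/- Let P, A₁, A₂, A₃ ∈ ℝ² with A₁, A₂, A₃ distinct from P, and suppose that each of the three angles at P between the segments PA₁, PA₂, PA₃ equals 2π/3. Then for every compact connected set Γ ⊆ ℝ² containing the three points A₁, A₂, A₃, the one-dimensional Hausdorff measure of Γ is at least |PA₁| + |PA₂| + |PA₃|, the total length of the tree PA₁ ∪ PA₂ ∪ PA₃. -/
open Set Metric EuclideanGeometry MeasureTheory
open scoped Real

noncomputable section

/-- Two points in the end sets of a chain of intersecting sets are at distance at most the total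
diameter of the chain. -/
theorem edist_le_sum_ediam_of_walk {X ι : Type*} [PseudoEMetricSpace X] {U : ι → Set X}
    {G : SimpleGraph ι} (hG : ∀ i j, G.Adj i j → (U i ∩ U j).Nonempty) {u v : ι}
    (p : G.Walk u v) {x y : X} (hx : x ∈ U u) (hy : y ∈ U v) :
    edist x y ≤ (p.support.map fun i => ediam (U i)).sum := by
  induction p generalizing x with
  | nil => simpa using edist_le_ediam_of_mem hx hy
  | cons h p ih =>
    obtain ⟨z, hz₁, hz₂⟩ := hG _ _ h
    simpa using (edist_triangle x z y).trans
      (add_le_add (edist_le_ediam_of_mem hx hz₁) (ih hz₂ hy))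

/-- In a connected graph, a vertex can be joined to a nonempty set of vertices by a path meeting
the set only at its starting point. -/
theorem exists_isPath_support_tail_disjoint {ι : Type*} {G : SimpleGraph ι} (hG : G.Preconnected)
    {s : Set ι} (hs : s.Nonempty) (c : ι) :
    ∃ v ∈ s, ∃ q : G.Walk v c, q.IsPath ∧ ∀ x ∈ q.support.tail, x ∉ s := by
  classical
  have hex : ∃ n, ∃ v ∈ s, ∃ q : G.Walk v c, q.length = n := by
    obtain ⟨v, hv⟩ := hs
    obtain ⟨q⟩ := hG v c
    exact ⟨_, v, hv, q, rfl⟩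
  obtain ⟨v, hv, q, hq⟩ := Nat.find_spec hex
  have hmin : ∀ w ∈ s, ∀ r : G.Walk w c, q.length ≤ r.length := fun w hw r =>
    hq.le.trans (Nat.find_min' hex ⟨w, hw, r, rfl⟩)
  refine ⟨v, hv, q.bypass, q.bypass_isPath, fun x hx hxs => ?_⟩
  have hle := q.length_bypass_le_length
  generalize q.bypass = r at hx hle
  cases r with
  | nil => simp at hx
  | cons h r =>
    have hx' : x ∈ r.support := by simpa using hx
    have h₁ := hmin x hxs (r.dropUntil x hx')
    have h₂ := r.length_dropUntil_le_length hx'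
    simp only [SimpleGraph.Walk.length_cons] at hle
    omega

/-- A connected set covered by open sets, each of which meets it, has a connected intersection
graph. -/
theorem preconnected_fromRel_of_isPreconnected {X ι : Type*} [TopologicalSpace X] {s : Set X}
    (hs : IsPreconnected s) {U : ι → Set X} (hU : ∀ i, IsOpen (U i))
    (hne : ∀ i, (s ∩ U i).Nonempty) (hcov : s ⊆ ⋃ i, U i) :
    (SimpleGraph.fromRel fun i j => (U i ∩ U j).Nonempty).Preconnected := by
  set G := SimpleGraph.fromRel fun i j => (U i ∩ U j).Nonempty
  intro i j
  by_contra hij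
  obtain ⟨x, -, hx₁, hx₂⟩ := hs (⋃ k ∈ {k | G.Reachable i k}, U k)
    (⋃ k ∈ {k | ¬ G.Reachable i k}, U k)
    (isOpen_biUnion fun k _ => hU k) (isOpen_biUnion fun k _ => hU k)
    (fun x hx => by
      obtain ⟨k, hk⟩ := mem_iUnion.1 (hcov hx)
      by_cases h : G.Reachable i k
      · exact Or.inl (mem_biUnion (mem_ofPred.2 h) hk)
      · exact Or.inr (mem_biUnion (mem_ofPred.2 h) hk))
    ((hne i).mono (inter_subset_inter_right _
      (subset_biUnion_of_mem (u := U) (mem_ofPred.2 (SimpleGraph.Reachable.refl i)))))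
    ((hne j).mono (inter_subset_inter_right _
      (subset_biUnion_of_mem (u := U) (mem_ofPred.2 hij))))
  obtain ⟨k, hk, hxk⟩ := mem_iUnion₂.1 hx₁
  obtain ⟨l, hl, hxl⟩ := mem_iUnion₂.1 hx₂
  have hkl : k ≠ l := by rintro rfl; exact hl hk
  have hadj : G.Adj k l := (SimpleGraph.fromRel_adj _ _ _).2 ⟨hkl, Or.inl ⟨x, hxk, hxl⟩⟩
  exact hl (SimpleGraph.Reachable.trans hk hadj.reachable)

/-- If a connected set is covered by open sets of diameter at most `r`, then any three of its points
are joined to a common point by segments of total length at most the sum of the diameters plus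
`2 * r`. -/
theorem exists_edist_add_le_tsum_ediam {X ι : Type*} [PseudoEMetricSpace X] {s : Set X}
    (hs : IsPreconnected s) {U : ι → Set X} (hU : ∀ i, IsOpen (U i)) (hcov : s ⊆ ⋃ i, U i)
    {r : ENNReal} (hr : ∀ i, ediam (U i) ≤ r) {a b c : X} (ha : a ∈ s) (hb : b ∈ s) (hc : c ∈ s) :
    ∃ q, edist a q + edist b q + edist c q ≤ ∑' i, ediam (U i) + 2 * r := by
  classical
  let V : {i // (s ∩ U i).Nonempty} → Set X := fun i => U i
  have hmem : ∀ x ∈ s, ∃ i, x ∈ V i := fun x hx => by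
    obtain ⟨i, hi⟩ := mem_iUnion.1 (hcov hx)
    exact ⟨⟨i, x, hx, hi⟩, hi⟩
  have hconn := preconnected_fromRel_of_isPreconnected hs (U := V) (fun i => hU i) (fun i => i.2)
    fun x hx => mem_iUnion.2 (hmem x hx)
  set G := SimpleGraph.fromRel fun i j => (V i ∩ V j).Nonempty
  have hadj : ∀ i j, G.Adj i j → (V i ∩ V j).Nonempty := fun i j h => by
    rcases ((SimpleGraph.fromRel_adj _ _ _).1 h).2 with h | h
    · exact h
    · rwa [inter_comm]
  obtain ⟨i, hi⟩ := hmem a ha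
  obtain ⟨j, hj⟩ := hmem b hb
  obtain ⟨k, hk⟩ := hmem c hc
  obtain ⟨p, hp⟩ := (hconn i j).exists_isPath
  obtain ⟨v, hv, t, ht, htp⟩ := exists_isPath_support_tail_disjoint hconn
    (s := {x | x ∈ p.support}) ⟨i, p.start_mem_support⟩ k
  obtain ⟨q, -, hq⟩ := v.2
  have hv' : v ∈ p.support := hv
  have h₁ := edist_le_sum_ediam_of_walk hadj (p.takeUntil v hv') hi hq
  have h₂ := edist_le_sum_ediam_of_walk hadj (p.dropUntil v hv') hq hj
  have h₃ := edist_le_sum_ediam_of_walk hadj t hq hk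
  rw [edist_comm] at h₂ h₃
  have hnodup : (p.support ++ t.support.tail).Nodup :=
    List.Nodup.append hp.support_nodup ht.support_nodup.tail fun x hx hx' => htp x hx' hx
  have hsum : ((p.support ++ t.support.tail).map fun i => ediam (V i)).sum
      ≤ ∑' i, ediam (U i) := by
    rw [← List.sum_toFinset _ hnodup]
    exact (ENNReal.sum_le_tsum _).trans
      (ENNReal.tsum_comp_le_tsum_of_injective Subtype.val_injective fun i => ediam (U i))
  have hsplit := congrArg SimpleGraph.Walk.support (p.take_spec hv')
  rw [SimpleGraph.Walk.support_append] at hsplit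
  rw [← hsplit] at hsum
  rw [← SimpleGraph.Walk.cons_tail_support] at h₂ h₃
  simp only [List.map_append, List.sum_append, List.map_cons, List.sum_cons] at h₂ h₃ hsum
  refine ⟨q, ?_⟩
  calc edist a q + edist b q + edist c q ≤ _ := add_le_add (add_le_add h₁ h₂) h₃
    _ = (_ + _ + _) + 2 * ediam (V v) := by ring
    _ ≤ _ := add_le_add hsum (mul_le_mul_right (hr v) 2)

/-- Up to an arbitrarily small error, the one-dimensional Hausdorff measure of a connected set bounds
the length of some tripod joining three given points of the set. -/
theorem exists_edist_add_le_hausdorffMeasure {X : Type*} [MetricSpace X] [MeasurableSpace X]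
    [BorelSpace X] {s : Set X} (hs : IsPreconnected s) {a b c : X} (ha : a ∈ s) (hb : b ∈ s)
    (hc : c ∈ s) {ε : NNReal} (hε : 0 < ε) :
    ∃ q, edist a q + edist b q + edist c q ≤ μH[1] s + ε := by
  by_cases htop : μH[1] s = ⊤
  · exact ⟨a, by simp [htop]⟩
  obtain ⟨η, rfl⟩ : ∃ η : NNReal, ε = 9 * η := ⟨ε / 9, by field_simp⟩
  have hη : 0 < η := by simpa using hε
  have hη' : (0 : ENNReal) < η := by exact_mod_cast hη
  have hlt := (Measure.hausdorffMeasure_apply 1 s).ge.trans_lt (ENNReal.lt_add_right htop hη'.ne')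
  have hlt := (le_iSup₂ (f := fun (r : ENNReal) (_ : 0 < r) =>
    ⨅ (t : ℕ → Set X) (_ : s ⊆ ⋃ n, t n) (_ : ∀ n, ediam (t n) ≤ r),
      ∑' n, ⨆ _ : (t n).Nonempty, ediam (t n) ^ (1 : ℝ)) (η : ENNReal) hη').trans_lt hlt
  simp only [iInf_lt_iff] at hlt
  obtain ⟨t, hcov, hdiam, hsum⟩ := hlt
  have hsum' : ∑' n, ediam (t n) ≤ μH[1] s + η := by
    refine (ENNReal.tsum_le_tsum fun n => ?_).trans hsum.le
    rcases (t n).eq_empty_or_nonempty with h | h <;> simp [h]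
  obtain ⟨δ, hδ, hδsum⟩ := ENNReal.exists_pos_sum_of_countable hη'.ne' ℕ
  have hthick : ∀ n, ediam (thickening (δ n) (t n)) ≤ ediam (t n) + 2 * δ n :=
    fun n => ediam_thickening_le (δ n)
  have hcov' : s ⊆ ⋃ n, thickening (δ n) (t n) :=
    hcov.trans (iUnion_mono fun n => self_subset_thickening (by exact_mod_cast hδ n) _)
  have hr : ∀ n, ediam (thickening (δ n) (t n)) ≤ 3 * η := fun n =>
    calc ediam (thickening (δ n) (t n)) ≤ ediam (t n) + 2 * δ n := hthick n
      _ ≤ η + 2 * η := by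
        gcongr
        · exact hdiam n
        · exact_mod_cast (ENNReal.le_tsum n).trans hδsum.le
      _ = 3 * η := by ring
  obtain ⟨q, hq⟩ := exists_edist_add_le_tsum_ediam hs (fun n => isOpen_thickening) hcov' hr ha hb hc
  refine ⟨q, hq.trans ?_⟩
  calc ∑' n, ediam (thickening (δ n) (t n)) + 2 * (3 * η)
      ≤ ∑' n, (ediam (t n) + 2 * δ n) + 2 * (3 * η) := by
        gcongr with n
        exact hthick n
    _ = ∑' n, ediam (t n) + 2 * ∑' n, (δ n : ENNReal) + 2 * (3 * η) := by
        rw [ENNReal.tsum_add, ENNReal.tsum_mul_left]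
    _ ≤ (μH[1] s + η) + 2 * η + 2 * (3 * η) := by gcongr
    _ = μH[1] s + ↑(9 * η) := by push_cast; ring

/-- A point from which three points are seen at mutual angles `2π/3` minimizes the sum of the
distances to these points. -/
theorem dist_add_dist_add_dist_le_of_angle_eq {V : Type*} [NormedAddCommGroup V]
    [InnerProductSpace ℝ V] {P A B C : V} (hA : A ≠ P) (hB : B ≠ P) (hC : C ≠ P)
    (hAB : ∠ A P B = 2 * π / 3) (hBC : ∠ B P C = 2 * π / 3) (hAC : ∠ A P C = 2 * π / 3) (Q : V) :
    dist P A + dist P B + dist P C ≤ dist A Q + dist B Q + dist C Q := by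
  have hcos : Real.cos (2 * π / 3) = -(1 / 2) := by
    rw [show 2 * π / 3 = π - π / 3 by ring, Real.cos_pi_sub, Real.cos_pi_div_three]
  have key : ∀ {X Y : V}, ∠ X P Y = 2 * π / 3 →
      inner ℝ (‖X - P‖⁻¹ • (X - P)) (‖Y - P‖⁻¹ • (Y - P)) = -(1 / 2) := fun {X Y} h => by
    rw [← hcos, ← h, EuclideanGeometry.angle, InnerProductGeometry.cos_angle, real_inner_smul_left,
      real_inner_smul_right, vsub_eq_sub, vsub_eq_sub]
    field_simp
  have hunit : ∀ {X : V}, X ≠ P → ‖‖X - P‖⁻¹ • (X - P)‖ = 1 := fun hX =>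
    norm_smul_inv_norm (𝕜 := ℝ) (sub_ne_zero.2 hX)
  have hproj : ∀ {X : V}, X ≠ P →
      dist P X + inner ℝ (P - Q) (‖X - P‖⁻¹ • (X - P)) ≤ dist X Q := fun {X} hX => by
    have h := real_inner_le_norm (X - Q) (‖X - P‖⁻¹ • (X - P))
    have hne := norm_ne_zero_iff.2 (sub_ne_zero.2 hX)
    rw [hunit hX, mul_one, ← sub_add_sub_cancel X P Q, inner_add_left,
      real_inner_smul_right (X - P), real_inner_self_eq_norm_sq, sq, inv_mul_cancel_left₀ hne,
      sub_add_sub_cancel] at h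
    rwa [dist_comm P X, dist_eq_norm, dist_eq_norm]
  set u := ‖A - P‖⁻¹ • (A - P)
  set v := ‖B - P‖⁻¹ • (B - P)
  set w := ‖C - P‖⁻¹ • (C - P)
  have hzero : u + v + w = 0 := by
    rw [← norm_eq_zero, ← sq_eq_zero_iff, norm_add_sq_real, norm_add_sq_real, inner_add_left,
      key hAB, key hBC, key hAC, hunit hA, hunit hB, hunit hC]
    norm_num
  have hinner : inner ℝ (P - Q) u + inner ℝ (P - Q) v + inner ℝ (P - Q) w = 0 := by
    rw [← inner_add_right, ← inner_add_right, hzero, inner_zero_right]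
  linarith [hproj hA, hproj hB, hproj hC]

/-- **Minimality of the Steiner tree.**  Let `P, A₁, A₂, A₃ ∈ ℝ²` with `A₁, A₂, A₃`
distinct from `P` and with each of the three angles at `P` between the segments
`PA₁`, `PA₂`, `PA₃` equal to `2π/3`.  Then any compact connected set `Γ` containing
`A₁, A₂, A₃` has one-dimensional Hausdorff measure at least
`|PA₁| + |PA₂| + |PA₃|`, the total length of the tree `PA₁ ∪ PA₂ ∪ PA₃`. -/
theorem steiner_tree_minimal (P A₁ A₂ A₃ : E2)
    (h₁ : A₁ ≠ P) (h₂ : A₂ ≠ P) (h₃ : A₃ ≠ P)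
    (hang₁₂ : ∠ A₁ P A₂ = 2 * π / 3)
    (hang₂₃ : ∠ A₂ P A₃ = 2 * π / 3)
    (hang₁₃ : ∠ A₁ P A₃ = 2 * π / 3)
    (Γ : Set E2) (hΓc : IsCompact Γ) (hΓconn : IsConnected Γ)
    (hA₁ : A₁ ∈ Γ) (hA₂ : A₂ ∈ Γ) (hA₃ : A₃ ∈ Γ) :
    ENNReal.ofReal (dist P A₁ + dist P A₂ + dist P A₃) ≤ μH[1] Γ := by
  refine ENNReal.le_of_forall_pos_le_add fun ε hε _ => ?_
  obtain ⟨Q, hQ⟩ :=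
    exists_edist_add_le_hausdorffMeasure hΓconn.isPreconnected hA₁ hA₂ hA₃ hε
  refine le_trans ?_ hQ
  rw [edist_dist, edist_dist, edist_dist, ← ENNReal.ofReal_add dist_nonneg dist_nonneg,
    ← ENNReal.ofReal_add (add_nonneg dist_nonneg dist_nonneg) dist_nonneg]
  exact ENNReal.ofReal_le_ofReal
    (dist_add_dist_add_dist_le_of_angle_eq h₁ h₂ h₃ hang₁₂ hang₂₃ hang₁₃ Q)

end
end

section
/- Let Ω ⊂ ℝ² be an open convex set and let f : Ω → ℝ be of class C³ with det D²f(x) = 0 and ∂²f/∂x₂²(x) ≠ 0 for every x ∈ Ω. Then every connected component of every level set {x ∈ Ω : ∂f/∂x₂(x) = s} (s ∈ ℝ) is contained in a straight line, and the gradient ∇f is constant on each such connected component; in other words, the graph of f is a ruled surface whose rulings are the level lines of ∂f/∂x₂. -/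
open Set Metric

noncomputable section

/-- The partial derivative `∂f/∂x₂`. -/
def pderiv₂ (f : E2 → ℝ) (x : E2) : ℝ := fderiv ℝ f x (EuclideanSpace.single 1 1)

/-- The directional derivative `x ↦ Df(x) a` of a `C^{n+1}` function is `C^n`. -/
lemma contDiffAt_fderiv_apply {g : E2 → ℝ} {x : E2} {n m : WithTop ℕ∞}
    (hg : ContDiffAt ℝ n g x) (hmn : m + 1 ≤ n) (a : E2) :
    ContDiffAt ℝ m (fun y => fderiv ℝ g y a) x :=
  (hg.fderiv_right hmn).clm_apply contDiffAt_const

/-- Symmetry of second directional derivatives. -/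
lemma fderiv_fderiv_apply_comm {g : E2 → ℝ} {x : E2} (hg : ContDiffAt ℝ 2 g x) (a b : E2) :
    fderiv ℝ (fun y => fderiv ℝ g y a) x b = fderiv ℝ (fun y => fderiv ℝ g y b) x a := by
  have hd : DifferentiableAt ℝ (fderiv ℝ g) x :=
    (hg.fderiv_right (m := 1) (by norm_num)).differentiableAt (by norm_num)
  have key : ∀ c d : E2,
      fderiv ℝ (fun y => fderiv ℝ g y c) x d = fderiv ℝ (fderiv ℝ g) x d c := by
    intro c d
    rw [fderiv_clm_apply hd (differentiableAt_const c)]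
    simp
  rw [key, key]
  exact (hg.isSymmSndFDerivAt (by simp)) b a

/-- The derivative of a function along an affine line. -/
lemma hasDerivAt_comp_line {g : E2 → ℝ} {p w : E2} {t : ℝ}
    (hg : DifferentiableAt ℝ g (p + t • w)) :
    HasDerivAt (fun r : ℝ => g (p + r • w)) (fderiv ℝ g (p + t • w) w) t := by
  have h1 : HasDerivAt (fun r : ℝ => p + r • w) w t := by
    simpa using ((hasDerivAt_id t).smul_const w).const_add p
  exact hg.hasFDerivAt.comp_hasDerivAt t h1

/-- A function whose derivative along a segment vanishes takes equal values at its ends. -/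
lemma eq_of_fderiv_segment_eq_zero {Ω : Set E2} (hconv : Convex ℝ Ω) {g : E2 → ℝ}
    (hg : ∀ x ∈ Ω, DifferentiableAt ℝ g x) {p w : E2} (hp : p ∈ Ω) (hq : p + w ∈ Ω)
    (h0 : ∀ t ∈ Icc (0 : ℝ) 1, fderiv ℝ g (p + t • w) w = 0) : g (p + w) = g p := by
  have hd : ∀ t ∈ Icc (0 : ℝ) 1, HasDerivAt (fun r : ℝ => g (p + r • w)) 0 t := fun t ht => by
    rw [← h0 t ht]
    exact hasDerivAt_comp_line (hg _ (hconv.add_smul_mem hp hq ht))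
  have := constant_of_has_deriv_right_zero (f := fun r : ℝ => g (p + r • w)) (a := 0) (b := 1)
    (fun t ht => (hd t ht).continuousAt.continuousWithinAt)
    (fun t ht => (hd t (Ico_subset_Icc_self ht)).hasDerivWithinAt) 1 (by simp)
  simpa using this

/-- A `C¹` solution of Burgers' equation `∂₁m = m ∂₂m` is constant along its characteristics,
the lines of direction `(1, -m)`. -/
lemma burgers_const_on_characteristic {Ω : Set E2} (hconv : Convex ℝ Ω) {m : E2 → ℝ}
    (hm : ∀ x ∈ Ω, ContDiffAt ℝ 1 m x)
    (hB : ∀ x ∈ Ω, fderiv ℝ m x (EuclideanSpace.single 0 1)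
      = m x * fderiv ℝ m x (EuclideanSpace.single 1 1))
    {p : E2} (hp : p ∈ Ω) {τ : ℝ}
    (hq : p + τ • (EuclideanSpace.single 0 1 - m p • EuclideanSpace.single 1 1 : E2) ∈ Ω) :
    m (p + τ • (EuclideanSpace.single 0 1 - m p • EuclideanSpace.single 1 1 : E2)) = m p := by
  set w : E2 := τ • (EuclideanSpace.single 0 1 - m p • EuclideanSpace.single 1 1 : E2) with hw
  have hmem : ∀ t ∈ Icc (0 : ℝ) 1, p + t • w ∈ Ω := fun t ht => hconv.add_smul_mem hp hq ht
  set k : ℝ → ℝ := fun t => τ * fderiv ℝ m (p + t • w) (EuclideanSpace.single 1 1) with hk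
  have hkc : ContinuousOn k (Icc 0 1) := by
    intro t ht
    have h1 : ContinuousAt (fun y => fderiv ℝ m y (EuclideanSpace.single 1 1 : E2)) (p + t • w) :=
      (contDiffAt_fderiv_apply (m := 0) (hm _ (hmem t ht)) (by norm_num) _).continuousAt
    have h2 : ContinuousAt (fun r : ℝ => p + r • w) t := by fun_prop
    exact (continuousAt_const.mul
      (ContinuousAt.comp (f := fun r : ℝ => p + r • w) h1 h2)).continuousWithinAt
  obtain ⟨K, hK⟩ := isCompact_Icc.exists_bound_of_continuousOn hkc
  have hd : ∀ t ∈ Icc (0 : ℝ) 1, HasDerivAt (fun r : ℝ => m (p + r • w) - m p)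
      (k t * (m (p + t • w) - m p)) t := by
    intro t ht
    have h1 := (hasDerivAt_comp_line (w := w)
      ((hm _ (hmem t ht)).differentiableAt (by norm_num))).sub_const (m p)
    have hLw : ∀ L : E2 →L[ℝ] ℝ, L w = τ * (L (EuclideanSpace.single 0 1)
        - m p * L (EuclideanSpace.single 1 1)) := by
      intro L
      rw [hw, map_smul, map_sub, map_smul, smul_eq_mul, smul_eq_mul]
    rw [hLw, hB _ (hmem t ht)] at h1
    refine h1.congr_deriv ?_
    simp only [hk]
    ring
  have := norm_le_gronwallBound_of_norm_deriv_right_le (δ := 0) (K := K) (ε := 0)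
    (f := fun r : ℝ => m (p + r • w) - m p) (a := 0) (b := 1)
    (fun t ht => (hd t ht).continuousAt.continuousWithinAt)
    (fun t ht => (hd t (Ico_subset_Icc_self ht)).hasDerivWithinAt) (by simp)
    (fun t ht => by
      rw [norm_mul, add_zero]
      exact mul_le_mul_of_nonneg_right (hK t (Ico_subset_Icc_self ht)) (norm_nonneg _))
    1 (by simp)
  rw [gronwallBound_ε0_δ0] at this
  simpa [sub_eq_zero] using this

/-- A function with nonvanishing derivative in a direction is injective along this direction. -/
lemma eq_zero_of_fderiv_apply_ne_zero {Ω : Set E2} (hconv : Convex ℝ Ω) {g : E2 → ℝ}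
    (hg : ∀ x ∈ Ω, DifferentiableAt ℝ g x) {p w : E2} (h0 : ∀ x ∈ Ω, fderiv ℝ g x w ≠ 0)
    {r : ℝ} (hp : p ∈ Ω) (hq : p + r • w ∈ Ω) (heq : g (p + r • w) = g p) : r = 0 := by
  have hd : ∀ t ∈ Icc (0 : ℝ) 1, HasDerivAt (fun t : ℝ => g (p + t • r • w))
      (fderiv ℝ g (p + t • r • w) (r • w)) t :=
    fun t ht => hasDerivAt_comp_line (hg _ (hconv.add_smul_mem hp hq ht))
  obtain ⟨t, ht, h⟩ := exists_hasDerivAt_eq_zero (f := fun t : ℝ => g (p + t • r • w))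
    (f' := fun t => fderiv ℝ g (p + t • r • w) (r • w)) (zero_lt_one' ℝ)
    (fun t ht => (hd t ht).continuousAt.continuousWithinAt) (by simpa using heq.symm)
    (fun t ht => hd t (Ioo_subset_Icc_self ht))
  rw [map_smul, smul_eq_mul] at h
  exact (mul_eq_zero.1 h).resolve_right
    (h0 _ (hconv.add_smul_mem hp hq (Ioo_subset_Icc_self ht)))

lemma eq_sum_single (x : E2) :
    x = x 0 • (EuclideanSpace.single 0 1 : E2) + x 1 • (EuclideanSpace.single 1 1 : E2) := by
  ext i
  fin_cases i <;> simp

/-- **Flat graphs are ruled along the level lines of `∂f/∂x₂`** (cf. Hartman–Wintner).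
If `f` is `C³` on an open convex `Ω ⊂ ℝ²` with `det D²f = 0` and `∂²f/∂x₂² ≠ 0`
everywhere, then each connected component of each level set `{∂f/∂x₂ = s}` lies on a
straight line and the gradient `∇f` is constant along it: the graph of `f` is a ruled
surface whose rulings are the level lines of `∂f/∂x₂`. -/
theorem flat_graph_is_ruled (Ω : Set E2) (hop : IsOpen Ω) (hconv : Convex ℝ Ω)
    (f : E2 → ℝ) (hf : ContDiffOn ℝ 3 f Ω)
    (hdet : ∀ x ∈ Ω, (hess f x).det = 0)
    (h22 : ∀ x ∈ Ω, pderiv2 1 1 f x ≠ 0)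
    (s : ℝ) (x₀ : E2) (hx₀ : x₀ ∈ {x ∈ Ω | pderiv₂ f x = s}) :
    ∃ a d : E2,
      connectedComponentIn {x ∈ Ω | pderiv₂ f x = s} x₀ ⊆ {p : E2 | ∃ t : ℝ, p = a + t • d} ∧
      ∀ x ∈ connectedComponentIn {x ∈ Ω | pderiv₂ f x = s} x₀,
        fderiv ℝ f x = fderiv ℝ f x₀ := by
  set e₀ : E2 := EuclideanSpace.single 0 1 with he₀
  set e₁ : E2 := EuclideanSpace.single 1 1 with he₁
  have hfx : ∀ x ∈ Ω, ContDiffAt ℝ 3 f x := fun x hx => hf.contDiffAt (hop.mem_nhds hx)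
  set u : E2 → ℝ := fun y => fderiv ℝ f y e₀
  set v : E2 → ℝ := fun y => fderiv ℝ f y e₁
  have huc : ∀ x ∈ Ω, ContDiffAt ℝ 2 u x := fun x hx =>
    contDiffAt_fderiv_apply (hfx x hx) (by norm_num) _
  have hvc : ∀ x ∈ Ω, ContDiffAt ℝ 2 v x := fun x hx =>
    contDiffAt_fderiv_apply (hfx x hx) (by norm_num) _
  have hud : ∀ x ∈ Ω, DifferentiableAt ℝ u x := fun x hx =>
    (huc x hx).differentiableAt (by norm_num)
  have hvd : ∀ x ∈ Ω, DifferentiableAt ℝ v x := fun x hx =>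
    (hvc x hx).differentiableAt (by norm_num)
  have hvy : ∀ x ∈ Ω, fderiv ℝ v x e₁ ≠ 0 := h22
  have huv : ∀ x ∈ Ω, fderiv ℝ u x e₁ = fderiv ℝ v x e₀ := fun x hx =>
    fderiv_fderiv_apply_comm ((hfx x hx).of_le (by norm_num)) _ _
  set m : E2 → ℝ := fun y => fderiv ℝ v y e₀ / fderiv ℝ v y e₁ with hm
  have hvx : ∀ x ∈ Ω, fderiv ℝ v x e₀ = m x * fderiv ℝ v x e₁ := fun x hx =>
    (div_mul_cancel₀ _ (hvy x hx)).symm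
  have hux : ∀ x ∈ Ω, fderiv ℝ u x e₀ = m x * fderiv ℝ v x e₀ := by
    intro x hx
    have h := hdet x hx
    rw [Matrix.det_fin_two] at h
    have h' : fderiv ℝ u x e₀ * fderiv ℝ v x e₁ - fderiv ℝ v x e₀ * fderiv ℝ u x e₁ = 0 := h
    rw [huv x hx] at h'
    simp only [hm]
    rw [div_mul_eq_mul_div, eq_div_iff (hvy x hx)]
    linarith
  have hvxc : ∀ x ∈ Ω, ContDiffAt ℝ 1 (fun y => fderiv ℝ v y e₀) x := fun x hx =>
    contDiffAt_fderiv_apply (hvc x hx) (by norm_num) _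
  have hvyc : ∀ x ∈ Ω, ContDiffAt ℝ 1 (fun y => fderiv ℝ v y e₁) x := fun x hx =>
    contDiffAt_fderiv_apply (hvc x hx) (by norm_num) _
  have hmc : ∀ x ∈ Ω, ContDiffAt ℝ 1 m x := fun x hx => (hvxc x hx).div (hvyc x hx) (hvy x hx)
  have hB : ∀ x ∈ Ω, fderiv ℝ m x e₀ = m x * fderiv ℝ m x e₁ := by
    intro x hx
    have hnx : Ω ∈ nhds x := hop.mem_nhds hx
    have hmd := (hmc x hx).differentiableAt (by norm_num)
    have hvxd := (hvxc x hx).differentiableAt (by norm_num)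
    have hvyd := (hvyc x hx).differentiableAt (by norm_num)
    have h1 : fderiv ℝ (fun y => fderiv ℝ v y e₀) x
        = fderiv ℝ (fun y => m y * fderiv ℝ v y e₁) x :=
      Filter.EventuallyEq.fderiv_eq (Filter.eventually_of_mem hnx hvx)
    have h2 : fderiv ℝ (fun y => fderiv ℝ u y e₀) x
        = fderiv ℝ (fun y => m y * fderiv ℝ v y e₀) x :=
      Filter.EventuallyEq.fderiv_eq (Filter.eventually_of_mem hnx hux)
    have h3 : fderiv ℝ (fun y => fderiv ℝ u y e₁) x = fderiv ℝ (fun y => fderiv ℝ v y e₀) x :=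
      Filter.EventuallyEq.fderiv_eq (Filter.eventually_of_mem hnx huv)
    rw [fderiv_fun_mul hmd hvyd] at h1
    rw [fderiv_fun_mul hmd hvxd] at h2
    have h1' := DFunLike.congr_fun h1 e₀
    have h2' := DFunLike.congr_fun h2 e₁
    have h4 := fderiv_fderiv_apply_comm (huc x hx) e₀ e₁
    have h5 := fderiv_fderiv_apply_comm (hvc x hx) e₀ e₁
    rw [h3] at h4
    simp only [add_apply, smul_apply, smul_eq_mul] at h1' h2'
    have h6 := hvx x hx
    apply mul_left_cancel₀ (hvy x hx)
    rw [h6] at h2'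
    linear_combination h2' - h1' - h4 + m x * h5
  obtain ⟨hx₀Ω, hx₀s⟩ := hx₀
  have hx₀s : v x₀ = s := hx₀s
  set d : E2 := e₀ - m x₀ • e₁ with hd
  have hmline : ∀ τ : ℝ, x₀ + τ • d ∈ Ω → m (x₀ + τ • d) = m x₀ := fun τ hτ =>
    burgers_const_on_characteristic hconv hmc hB hx₀Ω hτ
  have hline : ∀ g : E2 → ℝ, (∀ x ∈ Ω, DifferentiableAt ℝ g x) →
      (∀ x ∈ Ω, fderiv ℝ g x e₀ = m x * fderiv ℝ g x e₁) →
      ∀ τ : ℝ, x₀ + τ • d ∈ Ω → g (x₀ + τ • d) = g x₀ := by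
    intro g hg hge τ hτ
    refine eq_of_fderiv_segment_eq_zero hconv hg hx₀Ω hτ fun t ht => ?_
    have hmem := hconv.add_smul_mem hx₀Ω hτ ht
    rw [smul_smul] at hmem ⊢
    rw [map_smul, map_sub, map_smul, hge _ hmem, hmline _ hmem]
    simp
  have hvline := hline v hvd hvx
  have huline := hline u hud fun x hx => by rw [hux x hx, huv x hx]
  have hsub : connectedComponentIn {x ∈ Ω | pderiv₂ f x = s} x₀
      ⊆ {p : E2 | ∃ t : ℝ, p = x₀ + t • d} := by
    set S : Set E2 := {x ∈ Ω | pderiv₂ f x = s}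
    set C := connectedComponentIn S x₀
    have hCS : C ⊆ S := connectedComponentIn_subset S x₀
    have hx₀C : x₀ ∈ C := mem_connectedComponentIn ⟨hx₀Ω, hx₀s⟩
    set π : E2 → E2 := fun q => x₀ + (q 0 - x₀ 0) • d with hπ
    have hπc : Continuous π := by fun_prop
    have hvert : ∀ q : E2, ∃ r : ℝ, q = π q + r • e₁ := by
      intro q
      refine ⟨q 1 - x₀ 1 + (q 0 - x₀ 0) * m x₀, ?_⟩
      ext i
      fin_cases i
      · simp [hπ, hd, he₀, he₁]
      · simp [hπ, hd, he₀, he₁]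
        ring
    have hπS : ∀ q ∈ S, π q ∈ Ω → π q = q := by
      intro q hq hπq
      obtain ⟨r, hr⟩ := hvert q
      have hr0 : r = 0 := by
        refine eq_zero_of_fderiv_apply_ne_zero hconv hvd hvy hπq (hr ▸ hq.1) ?_
        rw [← hr, hvline _ hπq, hx₀s]
        exact hq.2
      rw [hr0, zero_smul, add_zero] at hr
      exact hr.symm
    by_contra hne
    obtain ⟨q, hqC, hq⟩ := not_subset.1 hne
    have hcover : C ⊆ π ⁻¹' Ω ∪ {y | π y ≠ y} := by
      intro y hy
      by_cases h : π y = y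
      · left
        rw [mem_preimage, h]
        exact (hCS hy).1
      · exact Or.inr h
    have hπx₀ : π x₀ = x₀ := by simp [hπ]
    obtain ⟨y, hyC, hy1, hy2⟩ := isPreconnected_connectedComponentIn (π ⁻¹' Ω) {y | π y ≠ y}
      (hop.preimage hπc) (isOpen_ne_fun hπc continuous_id) hcover
      ⟨x₀, hx₀C, by rwa [mem_preimage, hπx₀]⟩
      ⟨q, hqC, fun h => hq ⟨q 0 - x₀ 0, h.symm⟩⟩
    exact hy2 (hπS y (hCS hyC) hy1)
  refine ⟨x₀, d, hsub, fun x hx => ?_⟩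
  obtain ⟨t, rfl⟩ := hsub hx
  have hxΩ := (connectedComponentIn_subset _ _ hx).1
  ext z
  rw [eq_sum_single z]
  simp only [map_add, map_smul]
  congr 2
  · exact huline t hxΩ
  · exact hvline t hxΩ

end
end
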